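/- arXiv:2201.03764 — 2 statements merged into one kernel-verified Lean document; each statement's English description precedes it below -/
import Mathlib

section
/- (Integrated form of Lemma 3.3, inequality (3.16).) Under the hypotheses of the conditional Lemma 3.3 — n ≥ 3, Ω ⊂ ℝⁿ bounded open, A : Ω → ℝ^{n×n} measurable with |A(x) − A(x0)| ≤ Λ0 on Ω, x0, y0 ∈ Ω distinct, r := |x0 − y0|/5, δ > 0, η : ℝⁿ → ℝ Lipschitz with 0 ≤ η ≤ 1 and Lipschitz constant ≤ 4/δ, G : Ω \ {x0} → ℝ measurable with |G(x)| ≤ C0 |x − x0|^{2−n} on Ω \ {x0} and |G(x) − G(y)| ≤ C0 t r^{1−n} whenever t ∈ (0,r], x̄ ∈ Ω(y0,2r), x, y ∈ Ω(x̄,t), and g := −η·(A − A(x0))·G — there exists C = C(n, Λ0, C0) such that ∫_0^r ω_g(t, Ω(y0,2r)) / t dt ≤ C r^{2−n} ( ∫_0^r ω_A(t)/t dt + ((δ + r)/δ) · ϱ_A(8r, x0) ). -/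
open MeasureTheory Metric Set

/-- Mean oscillation `ω_f(r,x) = ⨍_{Ω(x,r)} |f - f̄_{Ω(x,r)}|` over `Ω(x,r) = Ω ∩ B(x,r)`. -/
noncomputable def meanOsc (n : ℕ) {V : Type*} [NormedAddCommGroup V] [NormedSpace ℝ V]
    (Ω : Set (EuclideanSpace ℝ (Fin n))) (f : EuclideanSpace ℝ (Fin n) → V) (r : ℝ)
    (x : EuclideanSpace ℝ (Fin n)) : ℝ :=
  ⨍ y in Ω ∩ ball x r, ‖f y - ⨍ z in Ω ∩ ball x r, f z‖

/-- `ω_f(r, D) = sup_{x ∈ D} ω_f(r,x)`. -/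
noncomputable def meanOscSup (n : ℕ) {V : Type*} [NormedAddCommGroup V] [NormedSpace ℝ V]
    (Ω : Set (EuclideanSpace ℝ (Fin n))) (f : EuclideanSpace ℝ (Fin n) → V) (r : ℝ)
    (D : Set (EuclideanSpace ℝ (Fin n))) : ℝ :=
  sSup ((fun x => meanOsc n Ω f r x) '' D)

/-- `ϱ_A(r, x0) = sup {|A(x) - A(x0)| : x ∈ Ω, |x - x0| ≤ r}`. -/
noncomputable def modCont (n : ℕ) {V : Type*} [NormedAddCommGroup V]
    (Ω : Set (EuclideanSpace ℝ (Fin n))) (A : EuclideanSpace ℝ (Fin n) → V) (r : ℝ)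
    (x0 : EuclideanSpace ℝ (Fin n)) : ℝ :=
  sSup {d : ℝ | ∃ x ∈ Ω, dist x x0 ≤ r ∧ d = ‖A x - A x0‖}

section Probability

variable {α V : Type*} [MeasurableSpace α] [NormedAddCommGroup V] [NormedSpace ℝ V]
  {ν : Measure α} [IsProbabilityMeasure ν]

/-- The mean oscillation is at most twice the mean distance to any constant. -/
lemma integral_norm_sub_integral_le [CompleteSpace V] {f : α → V} (hf : Integrable f ν) (c : V) :
    ∫ y, ‖f y - ∫ z, f z ∂ν‖ ∂ν ≤ 2 * ∫ y, ‖f y - c‖ ∂ν := by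
  have hfc : Integrable (fun y => f y - c) ν := hf.sub (integrable_const c)
  have hc : ‖c - ∫ z, f z ∂ν‖ ≤ ∫ y, ‖f y - c‖ ∂ν := by
    have : ∫ y, (f y - c) ∂ν = (∫ z, f z ∂ν) - c := by
      rw [integral_sub hf (integrable_const c)]; simp
    rw [norm_sub_rev, ← this]
    exact norm_integral_le_integral_norm _
  calc ∫ y, ‖f y - ∫ z, f z ∂ν‖ ∂ν
      ≤ ∫ y, (‖f y - c‖ + ‖c - ∫ z, f z ∂ν‖) ∂ν := by
        refine integral_mono (hf.sub (integrable_const _)).norm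
          (hfc.norm.add (integrable_const _)) fun y => ?_
        exact norm_sub_le_norm_sub_add_norm_sub _ _ _
    _ = (∫ y, ‖f y - c‖ ∂ν) + ‖c - ∫ z, f z ∂ν‖ := by
        rw [integral_add hfc.norm (integrable_const _)]; simp
    _ ≤ 2 * ∫ y, ‖f y - c‖ ∂ν := by linarith

/-- Mean oscillation of a product `φ • (A - A₀)`, where `φ` is close to the constant `a`. -/
lemma integral_norm_smul_sub_integral_le [CompleteSpace V] {φ : α → ℝ} {A : α → V} {A₀ : V}
    {a K M ρ : ℝ}
    (hA : Integrable A ν) (hφ : AEStronglyMeasurable φ ν) (hφa : ∀ᵐ y ∂ν, |φ y - a| ≤ K)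
    (ha : |a| ≤ M) (hρ : ∀ᵐ y ∂ν, ‖A y - A₀‖ ≤ ρ) :
    ∫ y, ‖φ y • (A y - A₀) - ∫ z, φ z • (A z - A₀) ∂ν‖ ∂ν
      ≤ 2 * (K * ρ + M * ∫ y, ‖A y - ∫ z, A z ∂ν‖ ∂ν) := by
  have hB : Integrable (fun y => A y - A₀) ν := hA.sub (integrable_const _)
  have hf : Integrable (fun y => φ y • (A y - A₀)) ν := by
    refine hB.bdd_smul (K + |a|) hφ ?_
    filter_upwards [hφa] with y hy
    have := abs_add_le (φ y - a) a
    rw [sub_add_cancel] at this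
    rw [Real.norm_eq_abs]
    linarith
  have hosc : Integrable (fun y => ‖A y - ∫ z, A z ∂ν‖) ν := (hA.sub (integrable_const _)).norm
  refine (integral_norm_sub_integral_le hf (a • ((∫ z, A z ∂ν) - A₀))).trans ?_
  gcongr
  calc ∫ y, ‖φ y • (A y - A₀) - a • ((∫ z, A z ∂ν) - A₀)‖ ∂ν
      ≤ ∫ y, (K * ρ + M * ‖A y - ∫ z, A z ∂ν‖) ∂ν := by
        refine integral_mono_ae (hf.sub (integrable_const _)).norm
          ((integrable_const _).add (hosc.const_mul _)) ?_
        filter_upwards [hφa, hρ] with y hy hy'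
        have e : φ y • (A y - A₀) - a • ((∫ z, A z ∂ν) - A₀)
            = (φ y - a) • (A y - A₀) + a • (A y - ∫ z, A z ∂ν) := by module
        rw [e]
        refine (norm_add_le _ _).trans ?_
        rw [norm_smul, norm_smul, Real.norm_eq_abs, Real.norm_eq_abs]
        have := (abs_nonneg _).trans hy
        gcongr
    _ = K * ρ + M * ∫ y, ‖A y - ∫ z, A z ∂ν‖ ∂ν := by
        rw [integral_add (integrable_const _) (hosc.const_mul _), integral_const,
          integral_const_mul, probReal_univ, one_smul]

end Probability

section MeanOsc

variable {n : ℕ} {V : Type*} [NormedAddCommGroup V]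
  {Ω : Set (EuclideanSpace ℝ (Fin n))}

lemma meanOsc_nonneg [NormedSpace ℝ V] (f : EuclideanSpace ℝ (Fin n) → V) (t : ℝ)
    (x : EuclideanSpace ℝ (Fin n)) :
    0 ≤ meanOsc n Ω f t x :=
  integral_nonneg fun _ => norm_nonneg _

lemma isProbabilityMeasure_restrict_inter_ball (hΩ : IsOpen Ω) {x : EuclideanSpace ℝ (Fin n)}
    (hx : x ∈ Ω) {t : ℝ} (ht : 0 < t) :
    IsProbabilityMeasure
      ((volume.restrict (Ω ∩ ball x t) univ)⁻¹ • volume.restrict (Ω ∩ ball x t)) := by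
  have hpos : volume (Ω ∩ ball x t) ≠ 0 :=
    ((hΩ.inter isOpen_ball).measure_pos volume ⟨x, hx, mem_ball_self ht⟩).ne'
  have hfin : volume (Ω ∩ ball x t) ≠ ⊤ :=
    ((measure_mono inter_subset_right).trans_lt measure_ball_lt_top).ne
  constructor
  rw [Measure.smul_apply, Measure.restrict_apply_univ, smul_eq_mul,
    ENNReal.inv_mul_cancel hpos hfin]

lemma ae_of_forall_mem_inter_ball (hΩ : IsOpen Ω) {x : EuclideanSpace ℝ (Fin n)} {t : ℝ}
    {p : EuclideanSpace ℝ (Fin n) → Prop} (h : ∀ y ∈ Ω ∩ ball x t, p y) :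
    ∀ᵐ y ∂((volume.restrict (Ω ∩ ball x t) univ)⁻¹ • volume.restrict (Ω ∩ ball x t)), p y :=
  Measure.ae_smul_measure
    ((ae_restrict_iff' (hΩ.inter isOpen_ball).measurableSet).2 (Filter.Eventually.of_forall h)) _

lemma integrable_of_norm_sub_le_inter_ball [MeasurableSpace V] [BorelSpace V]
    [SecondCountableTopology V] (hΩ : IsOpen Ω)
    {A : EuclideanSpace ℝ (Fin n) → V} (hA : Measurable A) {A₀ : V} {L : ℝ}
    (hL : ∀ y ∈ Ω, ‖A y - A₀‖ ≤ L)
    {x : EuclideanSpace ℝ (Fin n)} (hx : x ∈ Ω) {t : ℝ} (ht : 0 < t) :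
    Integrable A
      ((volume.restrict (Ω ∩ ball x t) univ)⁻¹ • volume.restrict (Ω ∩ ball x t)) := by
  have := isProbabilityMeasure_restrict_inter_ball hΩ hx ht
  refine Integrable.of_bound hA.aestronglyMeasurable (L + ‖A₀‖)
    (ae_of_forall_mem_inter_ball hΩ fun y hy => ?_)
  have h1 := norm_sub_norm_le (A y) A₀
  have h2 := hL y hy.1
  linarith

lemma meanOscSup_nonneg [NormedSpace ℝ V] (f : EuclideanSpace ℝ (Fin n) → V) (t : ℝ)
    (D : Set (EuclideanSpace ℝ (Fin n))) :
    0 ≤ meanOscSup n Ω f t D := by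
  refine Real.sSup_nonneg ?_
  rintro _ ⟨z, -, rfl⟩
  exact meanOsc_nonneg _ _ _

lemma meanOsc_le_meanOscSup [NormedSpace ℝ V] [MeasurableSpace V] [BorelSpace V]
    [SecondCountableTopology V] [CompleteSpace V] (hΩ : IsOpen Ω) {A : EuclideanSpace ℝ (Fin n) → V} (hA : Measurable A)
    {A₀ : V} {L : ℝ} (hL : ∀ y ∈ Ω, ‖A y - A₀‖ ≤ L)
    {x : EuclideanSpace ℝ (Fin n)} (hx : x ∈ Ω) {t : ℝ} (ht : 0 < t) :
    meanOsc n Ω A t x ≤ meanOscSup n Ω A t Ω := by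
  refine le_csSup ⟨2 * L, ?_⟩ ⟨x, hx, rfl⟩
  rintro _ ⟨z, hz, rfl⟩
  have := isProbabilityMeasure_restrict_inter_ball hΩ hz ht
  have hint := integrable_of_norm_sub_le_inter_ball hΩ hA hL hz ht
  refine (integral_norm_sub_integral_le hint A₀).trans ?_
  gcongr
  calc _ ≤ ∫ _, L ∂((volume.restrict (Ω ∩ ball z t) univ)⁻¹ • volume.restrict (Ω ∩ ball z t)) :=
        integral_mono_ae (hint.sub (integrable_const _)).norm (integrable_const _)
          (ae_of_forall_mem_inter_ball hΩ fun y hy => hL y hy.1)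
    _ = L := by rw [integral_const, probReal_univ, one_smul]

lemma norm_sub_le_modCont {A : EuclideanSpace ℝ (Fin n) → V} {x₀ : EuclideanSpace ℝ (Fin n)}
    {L : ℝ} (hL : ∀ y ∈ Ω, ‖A y - A x₀‖ ≤ L) {y : EuclideanSpace ℝ (Fin n)} (hy : y ∈ Ω) {R : ℝ}
    (hR : dist y x₀ ≤ R) : ‖A y - A x₀‖ ≤ modCont n Ω A R x₀ := by
  refine le_csSup ⟨L, ?_⟩ ⟨y, hy, hR, rfl⟩
  rintro _ ⟨z, hz, -, rfl⟩
  exact hL z hz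

lemma modCont_nonneg (A : EuclideanSpace ℝ (Fin n) → V) (R : ℝ) (x₀ : EuclideanSpace ℝ (Fin n)) :
    0 ≤ modCont n Ω A R x₀ := by
  refine Real.sSup_nonneg ?_
  rintro _ ⟨z, -, -, rfl⟩
  exact norm_nonneg _

end MeanOsc

/-- Pointwise bound for the mean oscillation of `-η (A - A(x₀)) G` at scale `t < r`. -/
lemma meanOscSup_cutoff_green_le {n : ℕ} (hn : 3 ≤ n) {L C₀ : ℝ} (hC₀ : 0 ≤ C₀)
    {Ω : Set (EuclideanSpace ℝ (Fin n))} (hΩ : IsOpen Ω)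
    {A : EuclideanSpace ℝ (Fin n) → EuclideanSpace ℝ (Fin n × Fin n)} (hA : Measurable A)
    {x₀ : EuclideanSpace ℝ (Fin n)} (hL : ∀ x ∈ Ω, ‖A x - A x₀‖ ≤ L)
    {y₀ : EuclideanSpace ℝ (Fin n)} {r : ℝ} (hr : 0 < r) (hr' : dist x₀ y₀ = 5 * r)
    {δ : ℝ} (hδ : 0 < δ)
    {η : EuclideanSpace ℝ (Fin n) → ℝ} (hη : ∀ x, η x ∈ Icc (0:ℝ) 1)
    (hηL : LipschitzWith (Real.toNNReal (4 / δ)) η)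
    {G : EuclideanSpace ℝ (Fin n) → ℝ} (hG : Measurable G)
    (hGb : ∀ x ∈ Ω \ {x₀}, |G x| ≤ C₀ * ‖x - x₀‖ ^ ((2:ℝ) - n))
    (hGL : ∀ t ∈ Ioc (0:ℝ) r, ∀ xb ∈ Ω ∩ ball y₀ (2 * r),
        ∀ x ∈ Ω ∩ ball xb t, ∀ y ∈ Ω ∩ ball xb t,
          |G x - G y| ≤ C₀ * t * r ^ ((1:ℝ) - n))
    {t : ℝ} (ht : t ∈ Ioo (0:ℝ) r) :
    meanOscSup n Ω (fun x => -((η x * G x) • (A x - A x₀))) t (Ω ∩ ball y₀ (2 * r)) ≤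
      2 * C₀ * r ^ ((2:ℝ) - n) *
        (meanOscSup n Ω A t Ω + t * (4 / δ + 1 / r) * modCont n Ω A (8 * r) x₀) := by
  obtain ⟨ht0, htr⟩ := ht
  have hP : 0 < r ^ ((2:ℝ) - n) := Real.rpow_pos_of_pos hr _
  have hpow : r ^ ((1:ℝ) - n) = r ^ ((2:ℝ) - n) * (1 / r) := by
    rw [show (1:ℝ) - n = (2 - n) - 1 by ring, Real.rpow_sub_one hr.ne']; ring
  have hsup : 0 ≤ meanOscSup n Ω A t Ω := meanOscSup_nonneg _ _ _
  have hmod := modCont_nonneg (Ω := Ω) A (8 * r) x₀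
  refine Real.sSup_le ?_ (by positivity)
  rintro _ ⟨x, ⟨hxΩ, hxb⟩, rfl⟩
  have hGsize : ∀ y ∈ Ω ∩ ball x t, |G y| ≤ C₀ * r ^ ((2:ℝ) - n) := by
    rintro y ⟨hyΩ, hyb⟩
    rw [mem_ball] at hyb hxb
    have hy : r ≤ dist y x₀ := by
      have h1 := dist_triangle4 x₀ y x y₀
      rw [dist_comm x₀ y] at h1
      linarith
    have hne : y ≠ x₀ := dist_pos.1 (hr.trans_le hy)
    refine (hGb y ⟨hyΩ, hne⟩).trans ?_
    rw [← dist_eq_norm]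
    have hn' : (3:ℝ) ≤ n := by exact_mod_cast hn
    exact mul_le_mul_of_nonneg_left
      (Real.rpow_le_rpow_of_nonpos hr hy (by linarith)) hC₀
  have hxx : x ∈ Ω ∩ ball x t := ⟨hxΩ, mem_ball_self ht0⟩
  have := isProbabilityMeasure_restrict_inter_ball hΩ hxΩ ht0
  have key := integral_norm_smul_sub_integral_le (A₀ := A x₀) (φ := fun y => -(η y * G y))
    (a := -(η x * G x)) (K := C₀ * r ^ ((2:ℝ) - n) * (t * (4 / δ + 1 / r)))
    (M := C₀ * r ^ ((2:ℝ) - n)) (ρ := modCont n Ω A (8 * r) x₀)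
    (integrable_of_norm_sub_le_inter_ball hΩ hA hL hxΩ ht0)
    ((hηL.continuous.measurable.mul hG).neg.aestronglyMeasurable)
    (ae_of_forall_mem_inter_ball hΩ fun y hy => ?_) ?_
    (ae_of_forall_mem_inter_ball hΩ fun y hy => ?_)
  · have hle : meanOsc n Ω A t x ≤ meanOscSup n Ω A t Ω := meanOsc_le_meanOscSup hΩ hA hL hxΩ ht0
    simp only [neg_smul] at key
    have key' : meanOsc n Ω (fun x => -((η x * G x) • (A x - A x₀))) t x ≤
      2 * (C₀ * r ^ ((2:ℝ) - n) * (t * (4 / δ + 1 / r)) * modCont n Ω A (8 * r) x₀ +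
        C₀ * r ^ ((2:ℝ) - n) * meanOsc n Ω A t x) := key
    have := mul_le_mul_of_nonneg_left hle (by positivity : 0 ≤ C₀ * r ^ ((2:ℝ) - n))
    refine key'.trans ?_
    linarith
  · have e : -(η y * G y) - -(η x * G x) = (η x - η y) * G y + η x * (G x - G y) := by ring
    rw [e]
    refine (abs_add_le _ _).trans ?_
    rw [abs_mul, abs_mul]
    have h1 : |η x - η y| ≤ 4 / δ * t := by
      have h := hηL.dist_le_mul x y
      rw [Real.coe_toNNReal _ (by positivity), Real.dist_eq] at h
      refine h.trans ?_
      have hyx : dist x y ≤ t := by rw [dist_comm]; exact (mem_ball.1 hy.2).le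
      gcongr
    have h2 : |η x| ≤ 1 := abs_le.2 ⟨by linarith [(hη x).1], (hη x).2⟩
    have h3 := hGL t ⟨ht0, htr.le⟩ x ⟨hxΩ, hxb⟩ x hxx y hy
    rw [hpow] at h3
    have h4 := hGsize y hy
    calc |η x - η y| * |G y| + |η x| * |G x - G y|
        ≤ 4 / δ * t * (C₀ * r ^ ((2:ℝ) - n)) + 1 * (C₀ * t * (r ^ ((2:ℝ) - n) * (1 / r))) := by
          gcongr
      _ = C₀ * r ^ ((2:ℝ) - n) * (t * (4 / δ + 1 / r)) := by ring
  · rw [abs_neg, abs_mul]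
    have h2 : |η x| ≤ 1 := abs_le.2 ⟨by linarith [(hη x).1], (hη x).2⟩
    calc |η x| * |G x| ≤ 1 * (C₀ * r ^ ((2:ℝ) - n)) := by
          gcongr
          exact hGsize x hxx
      _ = _ := one_mul _
  · refine norm_sub_le_modCont hL hy.1 ?_
    have h1 := dist_triangle4 y x y₀ x₀
    have h2 := mem_ball.1 hy.2
    have h3 := mem_ball.1 hxb
    rw [dist_comm y₀ x₀] at h1
    linarith

/-- integrated form of Lemma 3.3, inequality (3.16): under the hypotheses of the
conditional Lemma 3.3, with `g = -η (A - A(x0)) G` and `r = |x0 - y0|/5`,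
`∫_0^r ω_g(t, Ω(y0,2r))/t dt ≤ C r^{2-n} (∫_0^r ω_A(t)/t dt + ((δ+r)/δ) ϱ_A(8r,x0))`
with `C = C(n,Λ0,C0)`. Matrices `ℝ^{n×n}` are modelled as `EuclideanSpace ℝ (Fin n × Fin n)`. -/
theorem integral_meanOsc_cutoff_green_bound
    (n : ℕ) (hn : 3 ≤ n) (Λ0 C0 : ℝ) (hΛ0 : 0 ≤ Λ0) (hC0 : 0 ≤ C0) :
    ∃ C : ℝ, 0 < C ∧
    ∀ (Ω : Set (EuclideanSpace ℝ (Fin n))), Bornology.IsBounded Ω → IsOpen Ω →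
    ∀ (A : EuclideanSpace ℝ (Fin n) → EuclideanSpace ℝ (Fin n × Fin n)), Measurable A →
    ∀ x0 ∈ Ω, (∀ x ∈ Ω, ‖A x - A x0‖ ≤ Λ0) →
    ∀ y0 ∈ Ω, y0 ≠ x0 →
    ∀ r : ℝ, r = dist x0 y0 / 5 →
    ∀ δ : ℝ, 0 < δ →
    ∀ η : EuclideanSpace ℝ (Fin n) → ℝ, (∀ x, η x ∈ Icc (0:ℝ) 1) →
      LipschitzWith (Real.toNNReal (4 / δ)) η →
    ∀ G : EuclideanSpace ℝ (Fin n) → ℝ, Measurable G →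
      (∀ x ∈ Ω \ {x0}, |G x| ≤ C0 * ‖x - x0‖ ^ ((2:ℝ) - n)) →
      (∀ t ∈ Ioc (0:ℝ) r, ∀ xb ∈ Ω ∩ ball y0 (2 * r),
        ∀ x ∈ Ω ∩ ball xb t, ∀ y ∈ Ω ∩ ball xb t,
          |G x - G y| ≤ C0 * t * r ^ ((1:ℝ) - n)) →
    ∫⁻ t in Ioo (0:ℝ) r,
        ENNReal.ofReal
          (meanOscSup n Ω (fun x => -((η x * G x) • (A x - A x0))) t (Ω ∩ ball y0 (2 * r)) / t)
      ≤ ENNReal.ofReal (C * r ^ ((2:ℝ) - n)) *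
          ((∫⁻ t in Ioo (0:ℝ) r, ENNReal.ofReal (meanOscSup n Ω A t Ω / t))
            + ENNReal.ofReal ((δ + r) / δ * modCont n Ω A (8 * r) x0)) := by
  refine ⟨8 * C0 + 1, by positivity, ?_⟩
  intro Ω _ hΩ A hA x0 _ hL y0 _ hne r hr δ hδ η hη hηL G hG hGb hGL
  have hr0 : 0 < r := by
    have := dist_pos.2 hne.symm
    rw [hr]; positivity
  have hr5 : dist x0 y0 = 5 * r := by rw [hr]; ring
  have hP : 0 < r ^ ((2:ℝ) - n) := Real.rpow_pos_of_pos hr0 _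
  have hmod := modCont_nonneg (Ω := Ω) A (8 * r) x0
  have hbound : ∀ t ∈ Ioo (0:ℝ) r,
      ENNReal.ofReal
        (meanOscSup n Ω (fun x => -((η x * G x) • (A x - A x0))) t (Ω ∩ ball y0 (2 * r)) / t)
      ≤ ENNReal.ofReal ((8 * C0 + 1) * r ^ ((2:ℝ) - n)) *
        (ENNReal.ofReal (meanOscSup n Ω A t Ω / t) +
          ENNReal.ofReal ((1 / δ + 1 / r) * modCont n Ω A (8 * r) x0)) := by
    intro t ht
    have h := meanOscSup_cutoff_green_le hn hC0 hΩ hA hL hr0 hr5 hδ hη hηL hG hGb hGL ht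
    have hosc : 0 ≤ meanOscSup n Ω A t Ω := meanOscSup_nonneg _ _ _
    have ht0 := ht.1
    rw [← ENNReal.ofReal_add (by positivity) (by positivity),
      ← ENNReal.ofReal_mul (by positivity)]
    refine ENNReal.ofReal_le_ofReal ?_
    rw [div_le_iff₀ ht0]
    refine h.trans ?_
    have e : (8 * C0 + 1) * r ^ ((2:ℝ) - n) *
          (meanOscSup n Ω A t Ω / t + (1 / δ + 1 / r) * modCont n Ω A (8 * r) x0) * t =
        (2 * C0 + 1 / 4) * r ^ ((2:ℝ) - n) * (4 * meanOscSup n Ω A t Ω +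
          t * (4 / δ + 4 / r) * modCont n Ω A (8 * r) x0) := by
      field_simp; ring
    rw [e]
    gcongr <;> linarith
  calc _ ≤ ∫⁻ t in Ioo (0:ℝ) r, ENNReal.ofReal ((8 * C0 + 1) * r ^ ((2:ℝ) - n)) *
        (ENNReal.ofReal (meanOscSup n Ω A t Ω / t) +
          ENNReal.ofReal ((1 / δ + 1 / r) * modCont n Ω A (8 * r) x0)) :=
        setLIntegral_mono' measurableSet_Ioo hbound
    _ = _ := by
        rw [lintegral_const_mul' _ _ ENNReal.ofReal_ne_top,
          lintegral_add_right _ measurable_const, setLIntegral_const, Real.volume_Ioo,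
          ← ENNReal.ofReal_mul (by positivity)]
        congr 3
        field_simp
        ring
end

section
/- (Conditional form of the oscillation estimate (4.7) in the proof of Theorem 1.2.) Let n ≥ 3, let Ω ⊂ ℝⁿ be a bounded open set, let A : Ω → ℝ^{n×n} be measurable, let x0 ∈ Ω, and suppose |A(x) − A(x0)| ≤ Λ0 for all x ∈ Ω. Let y0 ∈ Ω with y0 ≠ x0 and set r := |y0 − x0|/5. Let C0 ≥ 0 and let H : Ω \ {x0} → ℝ be measurable with (i) |H(x)| ≤ C0 |x − x0|^{−n} for all x ∈ Ω \ {x0}, and (ii) |H(x) − H(y)| ≤ C0 t r^{−n−1} whenever t ∈ (0,r], x̄ ∈ Ω(y0, 2r), and x, y ∈ Ω(x̄, t). Define f := −(A − A(x0))·H on Ω \ {x0}. Then there exists C = C(n, Λ0, C0) such that for all t ∈ (0,r]: ω_f(t, Ω(y0,2r)) ≤ C r^{−n} ( ω_A(t) + (t/r) · ϱ_A(8r, x0) ). -/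
open MeasureTheory Metric Set

/-- The mean oscillation of `f` around its mean is at most twice that around any constant. -/
theorem integral_norm_sub_integral_le_two_mul {α V : Type*} [MeasurableSpace α]
    [NormedAddCommGroup V] [NormedSpace ℝ V] [CompleteSpace V] {ν : Measure α}
    [IsProbabilityMeasure ν] {f : α → V} (hf : Integrable f ν) (c : V) :
    ∫ y, ‖f y - ∫ z, f z ∂ν‖ ∂ν ≤ 2 * ∫ y, ‖f y - c‖ ∂ν := by
  have hfc : Integrable (fun y => f y - c) ν := hf.sub (integrable_const c)
  have hm : ‖c - ∫ z, f z ∂ν‖ ≤ ∫ y, ‖f y - c‖ ∂ν := by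
    have : ∫ y, (f y - c) ∂ν = (∫ z, f z ∂ν) - c := by
      rw [integral_sub hf (integrable_const c)]; simp
    rw [norm_sub_rev, ← this]
    exact norm_integral_le_integral_norm _
  calc ∫ y, ‖f y - ∫ z, f z ∂ν‖ ∂ν
      ≤ ∫ y, (‖f y - c‖ + ‖c - ∫ z, f z ∂ν‖) ∂ν := by
        refine integral_mono (hf.sub (integrable_const _)).norm
          (hfc.norm.add (integrable_const _)) fun y => ?_
        exact norm_sub_le_norm_sub_add_norm_sub _ _ _
    _ = (∫ y, ‖f y - c‖ ∂ν) + ‖c - ∫ z, f z ∂ν‖ := by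
        rw [integral_add hfc.norm (integrable_const _)]; simp
    _ ≤ 2 * ∫ y, ‖f y - c‖ ∂ν := by linarith

theorem integrable_of_ae_norm_sub_le {α V : Type*} [MeasurableSpace α]
    [NormedAddCommGroup V] {ν : Measure α} [IsFiniteMeasure ν] {f : α → V} {c : V} {ρ : ℝ}
    (hf : AEStronglyMeasurable f ν) (hρ : ∀ᵐ x ∂ν, ‖f x - c‖ ≤ ρ) : Integrable f ν := by
  refine Integrable.of_bound hf (ρ + ‖c‖) ?_
  filter_upwards [hρ] with x hx
  have := norm_le_norm_sub_add (f x) c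
  linarith

/-- Mean oscillation of a product of a bounded field with a scalar function that is close
to a constant. -/
theorem integral_norm_smul_sub_integral_le_s12 {α V : Type*} [MeasurableSpace α]
    [NormedAddCommGroup V] [NormedSpace ℝ V] [CompleteSpace V] {ν : Measure α}
    [IsProbabilityMeasure ν] {A : α → V} {H : α → ℝ} {a : V} {h ρ δ M : ℝ}
    (hA : AEStronglyMeasurable A ν) (hH : AEStronglyMeasurable H ν)
    (hAρ : ∀ᵐ x ∂ν, ‖A x - a‖ ≤ ρ) (hHδ : ∀ᵐ x ∂ν, |H x - h| ≤ δ) (hM : |h| ≤ M) :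
    ∫ y, ‖-(H y • (A y - a)) - ∫ z, -(H z • (A z - a)) ∂ν‖ ∂ν
      ≤ 2 * (δ * ρ + M * ∫ y, ‖A y - ∫ z, A z ∂ν‖ ∂ν) := by
  have hBi : Integrable (fun x => A x - a) ν :=
    Integrable.of_bound (hA.sub aestronglyMeasurable_const) ρ hAρ
  have hAi : Integrable A ν := integrable_of_ae_norm_sub_le hA hAρ
  have hfi : Integrable (fun x => -(H x • (A x - a))) ν := by
    refine (hBi.bdd_smul (δ + M) hH ?_).neg
    filter_upwards [hHδ] with x hx
    have := abs_add_le (H x - h) h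
    rw [sub_add_cancel] at this
    rw [Real.norm_eq_abs]
    linarith
  set m := ∫ z, A z ∂ν with hm
  have hosc : Integrable (fun y => ‖A y - m‖) ν := (hAi.sub (integrable_const m)).norm
  refine (integral_norm_sub_integral_le_two_mul hfi (-(h • (m - a)))).trans ?_
  gcongr
  calc ∫ y, ‖-(H y • (A y - a)) - -(h • (m - a))‖ ∂ν
      ≤ ∫ y, (δ * ρ + M * ‖A y - m‖) ∂ν := by
        refine integral_mono_ae (hfi.sub (integrable_const _)).norm
          ((integrable_const _).add (hosc.const_mul M)) ?_
        filter_upwards [hAρ, hHδ] with y hy1 hy2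
        have key : -(H y • (A y - a)) - -(h • (m - a))
            = -((H y - h) • (A y - a) + h • (A y - m)) := by module
        change ‖-(H y • (A y - a)) - -(h • (m - a))‖ ≤ δ * ρ + M * ‖A y - m‖
        rw [key, norm_neg]
        refine (norm_add_le _ _).trans ?_
        rw [norm_smul, norm_smul, Real.norm_eq_abs, Real.norm_eq_abs]
        have : 0 ≤ δ := (abs_nonneg _).trans hy2
        gcongr
    _ = δ * ρ + M * ∫ y, ‖A y - m‖ ∂ν := by
        rw [integral_add (integrable_const _) (hosc.const_mul M), integral_const,
          probReal_univ, one_smul, integral_const_mul]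

theorem isProbabilityMeasure_average_of_isOpen {n : ℕ} {U : Set (EuclideanSpace ℝ (Fin n))}
    (hU : IsOpen U) (hb : Bornology.IsBounded U) (hne : U.Nonempty) :
    IsProbabilityMeasure
      (((volume.restrict U) univ)⁻¹ • (volume.restrict U :
        Measure (EuclideanSpace ℝ (Fin n)))) := by
  have : Fact (volume U < ⊤) := ⟨hb.measure_lt_top⟩
  have : NeZero (volume.restrict U : Measure (EuclideanSpace ℝ (Fin n))) := by
    refine ⟨fun h0 => ?_⟩
    exact (hU.measure_pos volume hne).ne' (Measure.restrict_eq_zero.1 h0)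
  infer_instance

theorem ae_average_of_forall_mem {n : ℕ} {U : Set (EuclideanSpace ℝ (Fin n))}
    (hU : MeasurableSet U) {p : EuclideanSpace ℝ (Fin n) → Prop} (hp : ∀ x ∈ U, p x) :
    ∀ᵐ x ∂(((volume.restrict U) univ)⁻¹ • (volume.restrict U :
        Measure (EuclideanSpace ℝ (Fin n)))), p x :=
  Measure.ae_smul_measure (ae_restrict_of_forall_mem hU hp) _

/-- conditional form of the oscillation estimate (4.7) in the proof of
Theorem 1.2: with `r = |y0 - x0|/5` and `H` (playing the role of `D²_x G_{x0}(·,x0)`)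
satisfying `|H(x)| ≤ C0 |x - x0|^{-n}` on `Ω \ {x0}` and the oscillation bound (ii), the
function `f = -(A - A(x0)) H` satisfies, for `0 < t ≤ r`,
`ω_f(t, Ω(y0,2r)) ≤ C r^{-n} (ω_A(t) + (t/r) ϱ_A(8r,x0))` with `C = C(n,Λ0,C0)`.
Matrices `ℝ^{n×n}` are modelled as `EuclideanSpace ℝ (Fin n × Fin n)`. -/
theorem meanOsc_coeff_times_H_bound
    (n : ℕ) (hn : 3 ≤ n) (Λ0 C0 : ℝ) (hΛ0 : 0 ≤ Λ0) (hC0 : 0 ≤ C0) :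
    ∃ C : ℝ, 0 < C ∧
    ∀ (Ω : Set (EuclideanSpace ℝ (Fin n))), Bornology.IsBounded Ω → IsOpen Ω →
    ∀ (A : EuclideanSpace ℝ (Fin n) → EuclideanSpace ℝ (Fin n × Fin n)), Measurable A →
    ∀ x0 ∈ Ω, (∀ x ∈ Ω, ‖A x - A x0‖ ≤ Λ0) →
    ∀ y0 ∈ Ω, y0 ≠ x0 →
    ∀ r : ℝ, r = dist y0 x0 / 5 →
    ∀ H : EuclideanSpace ℝ (Fin n) → ℝ, Measurable H →
      (∀ x ∈ Ω \ {x0}, |H x| ≤ C0 * ‖x - x0‖ ^ (-(n : ℝ))) →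
      (∀ t ∈ Ioc (0:ℝ) r, ∀ xb ∈ Ω ∩ ball y0 (2 * r),
        ∀ x ∈ Ω ∩ ball xb t, ∀ y ∈ Ω ∩ ball xb t,
          |H x - H y| ≤ C0 * t * r ^ (-(n : ℝ) - 1)) →
    ∀ t ∈ Ioc (0:ℝ) r,
      meanOscSup n Ω (fun x => -(H x • (A x - A x0))) t (Ω ∩ ball y0 (2 * r))
        ≤ C * r ^ (-(n : ℝ)) *
            (meanOscSup n Ω A t Ω + (t / r) * modCont n Ω A (8 * r) x0) := by
  refine ⟨2 * C0 + 1, by positivity, ?_⟩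
  intro Ω hΩb hΩo A hA x0 hx0 hAΛ y0 hy0 hne r hr H hH hi hii t ht
  obtain ⟨ht0, htr⟩ := ht
  have hr0 : 0 < r := ht0.trans_le htr
  have hdist : dist y0 x0 = 5 * r := by linarith
  have hopen : ∀ x, IsOpen (Ω ∩ ball x t) := fun x => hΩo.inter isOpen_ball
  have hprob : ∀ x ∈ Ω, IsProbabilityMeasure (((volume.restrict (Ω ∩ ball x t)) univ)⁻¹ •
      (volume.restrict (Ω ∩ ball x t) : Measure (EuclideanSpace ℝ (Fin n)))) := fun x hx =>
    isProbabilityMeasure_average_of_isOpen (hopen x) (hΩb.subset inter_subset_left)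
      ⟨x, hx, mem_ball_self ht0⟩
  have hAnn : ∀ x, 0 ≤ meanOsc n Ω A t x := fun x => integral_nonneg fun _ => norm_nonneg _
  have hbdd : BddAbove ((fun x => meanOsc n Ω A t x) '' Ω) := by
    refine ⟨2 * Λ0, ?_⟩
    rintro _ ⟨x, hx, rfl⟩
    have := hprob x hx
    have hae := ae_average_of_forall_mem (hopen x).measurableSet
      (p := fun y => ‖A y - A x0‖ ≤ Λ0) fun y hy => hAΛ y hy.1
    have hAi := integrable_of_ae_norm_sub_le hA.aestronglyMeasurable hae
    refine (integral_norm_sub_integral_le_two_mul hAi (A x0)).trans ?_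
    gcongr
    refine (integral_mono_ae (hAi.sub (integrable_const _)).norm
      (integrable_const Λ0) hae).trans ?_
    rw [integral_const, probReal_univ, one_smul]
  have hρ : ∀ x ∈ Ω, dist x x0 ≤ 8 * r → ‖A x - A x0‖ ≤ modCont n Ω A (8 * r) x0 := by
    intro x hx hd
    refine le_csSup ⟨Λ0, ?_⟩ ⟨x, hx, hd, rfl⟩
    rintro _ ⟨z, hz, -, rfl⟩
    exact hAΛ z hz
  have hρ0 : 0 ≤ modCont n Ω A (8 * r) x0 :=
    (norm_nonneg _).trans (hρ x0 hx0 (by simp; positivity))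
  have hsup0 : 0 ≤ meanOscSup n Ω A t Ω :=
    (hAnn x0).trans (le_csSup hbdd (mem_image_of_mem _ hx0))
  refine csSup_le (Set.Nonempty.image _ ⟨y0, hy0, mem_ball_self (by positivity)⟩) ?_
  rintro _ ⟨x, ⟨hx, hxy⟩, rfl⟩
  have := hprob x hx
  rw [mem_ball] at hxy
  have hM : |H x| ≤ C0 * r ^ (-(n : ℝ)) := by
    have hd : r ≤ dist x x0 := by
      have := dist_triangle_left y0 x0 x
      linarith
    have hxne : x ∉ ({x0} : Set _) := fun h => by
      rw [mem_singleton_iff.1 h, dist_self] at hd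
      linarith
    refine (hi x ⟨hx, hxne⟩).trans ?_
    rw [← dist_eq_norm]
    gcongr C0 * ?_
    exact Real.rpow_le_rpow_of_nonpos hr0 hd (by simp)
  have hmain := integral_norm_smul_sub_integral_le_s12
    hA.aestronglyMeasurable hH.aestronglyMeasurable
    (ae_average_of_forall_mem (hopen x).measurableSet
      (p := fun y => ‖A y - A x0‖ ≤ modCont n Ω A (8 * r) x0) fun y hy => hρ y hy.1 (by
        have h1 := mem_ball.1 hy.2
        have h2 := dist_triangle4 y x y0 x0
        linarith))
    (ae_average_of_forall_mem (hopen x).measurableSet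
      (p := fun y => |H y - H x| ≤ C0 * t * r ^ (-(n : ℝ) - 1)) fun y hy =>
        hii t ⟨ht0, htr⟩ x ⟨hx, hxy⟩ y hy x ⟨hx, mem_ball_self ht0⟩) hM
  change _ ≤ 2 * (_ + _ * meanOsc n Ω A t x) at hmain
  refine le_trans hmain ?_
  have hosc : meanOsc n Ω A t x ≤ meanOscSup n Ω A t Ω :=
    le_csSup hbdd (mem_image_of_mem _ hx)
  have hrn : 0 < r ^ (-(n : ℝ)) := Real.rpow_pos_of_pos hr0 _
  calc 2 * (C0 * t * r ^ (-(n : ℝ) - 1) * modCont n Ω A (8 * r) x0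
          + C0 * r ^ (-(n : ℝ)) * meanOsc n Ω A t x)
      ≤ 2 * (C0 * t * r ^ (-(n : ℝ) - 1) * modCont n Ω A (8 * r) x0
          + C0 * r ^ (-(n : ℝ)) * meanOscSup n Ω A t Ω) := by gcongr
    _ = 2 * C0 * r ^ (-(n : ℝ)) *
          (meanOscSup n Ω A t Ω + (t / r) * modCont n Ω A (8 * r) x0) := by
        rw [Real.rpow_sub_one hr0.ne']; ring
    _ ≤ _ := by
        gcongr
        linarith
end
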